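/- arXiv:1809.07254 — 2 statements merged into one kernel-verified Lean document; each statement's English description precedes it below -/
import Mathlib

section
/- Let n ≥ 1, α ≥ 1, ε ∈ (0, 1/2), μ ∈ ℝⁿ, Σ a symmetric n×n real matrix, a ∈ ℝⁿ, b ∈ ℝ, and let Ξ ⊆ ℝⁿ be a nonempty compact set. Assume that for every m ∈ Ξ the matrix ((α+2)/α)(Σ − μμᵀ) − (1/α²)(μ − m)(μ − m)ᵀ is positive definite and aᵀm ≤ b. For m ∈ Ξ, let Λ(m) be the positive semidefinite square root of ((α+2)/α)(Σ − μμᵀ) − (1/α²)(μ − m)(μ − m)ᵀ. Then every Borel probability distribution P on ℝⁿ that has mean μ, second moment matrix Σ, and is α-unimodal with mode m for some m ∈ Ξ, satisfies P({ξ : aᵀξ ≤ b}) ≥ 1 − ε, if and only if for every m ∈ Ξ and every τ ≥ (1/(1−ε))^{1/α}: √((1−ε−τ^{−α})/ε)·‖Λ(m) a‖ ≤ τ(b − μᵀa) + (τ − (α+1)/α)·(μ − m)ᵀa. -/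
open MeasureTheory Matrix Pointwise

/-- A Borel probability distribution `P` on `ℝⁿ` is `α`-unimodal with mode `m` if the
pushforward of `P` under `x ↦ x - m` is `α`-unimodal with mode `0`, i.e. for every Borel set
`B` the map `t ↦ t^α * P((1/t) • B)` is nondecreasing on `t > 0`. -/
def AlphaUnimodal {n : ℕ} (α : ℝ) (m : Fin n → ℝ) (P : Measure (Fin n → ℝ)) : Prop :=
  ∀ B : Set (Fin n → ℝ), MeasurableSet B →
    MonotoneOn (fun t : ℝ => t ^ α * ((P.map (fun x => x - m)) ((1 / t) • B)).toReal)
      (Set.Ioi (0 : ℝ))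

theorem convexOn_const_div_rpow {α c : ℝ} (hα : 1 ≤ α) (hc : 0 ≤ c) :
    ConvexOn ℝ (Set.Ioi c) (fun x : ℝ => (c / x) ^ α) := by
  refine ⟨convex_Ioi c, fun x hx y hy p q hp hq hpq => ?_⟩
  have hx0 : 0 < x := hc.trans_lt hx
  have hy0 : 0 < y := hc.trans_lt hy
  simp only [smul_eq_mul]
  have hinv := (convexOn_zpow (𝕜 := ℝ) (-1)).2 hx0 hy0 hp hq hpq
  simp only [smul_eq_mul, _root_.zpow_neg_one] at hinv
  have hpos : 0 < p * x + q * y := (convex_Ioi (0 : ℝ)) hx0 hy0 hp hq hpq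
  have hle : c / (p * x + q * y) ≤ p * (c / x) + q * (c / y) := by
    have := mul_le_mul_of_nonneg_left hinv hc
    calc c / (p * x + q * y) = c * (p * x + q * y)⁻¹ := div_eq_mul_inv _ _
      _ ≤ _ := this
      _ = _ := by ring
  calc (c / (p * x + q * y)) ^ α ≤ (p * (c / x) + q * (c / y)) ^ α :=
        Real.rpow_le_rpow (by positivity) hle (by linarith)
    _ ≤ _ := (convexOn_rpow hα).2 (x := c / x) (y := c / y) (Set.mem_Ici.2 (by positivity))
        (Set.mem_Ici.2 (by positivity)) hp hq hpq

/-- A line separates a convex parabola from the concave function `1 - (c / w) ^ α` below it. -/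
theorem exists_line_between {α ε c V w₀ : ℝ} (hα : 1 ≤ α) (hε : 0 < ε) (hc : 0 ≤ c) (hV : 0 < V)
    (h : ∀ w, c < w → 1 - (c / w) ^ α ≤ ε + ε / V * (w - w₀) ^ 2) :
    ∃ A l : ℝ, (∀ w, c < w → 1 - (c / w) ^ α ≤ l + A * (w - w₀)) ∧
      ∀ w, l + A * (w - w₀) ≤ ε + ε / V * (w - w₀) ^ 2 := by
  have hconc : ConcaveOn ℝ (Set.Ioi c) (fun w : ℝ => 1 - (c / w) ^ α) :=
    (concaveOn_const 1 (convex_Ioi c)).sub (convexOn_const_div_rpow hα hc)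
  have hconv : ConvexOn ℝ Set.univ (fun w : ℝ => ε + ε / V * (w - w₀) ^ 2) := by
    refine ⟨convex_univ, fun x _ y _ p q hp hq hpq => ?_⟩
    simp only [smul_eq_mul]
    have hq' : q = 1 - p := by linarith
    subst hq'
    have : 0 ≤ ε / V * (p * (1 - p) * (x - y) ^ 2) := by positivity
    nlinarith [this]
  have hopen : IsOpen {p : ℝ × ℝ | p.1 ∈ Set.Ioi c ∧ p.2 < 1 - (c / p.1) ^ α} := by
    have hco : ContinuousOn (fun p : ℝ × ℝ => 1 - (c / p.1) ^ α - p.2) (Prod.fst ⁻¹' Set.Ioi c) := by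
      refine ContinuousOn.sub (continuousOn_const.sub (ContinuousOn.rpow_const ?_ ?_))
        continuous_snd.continuousOn
      · exact continuousOn_const.div continuous_fst.continuousOn
          fun p hp => (hc.trans_lt hp).ne'
      · exact fun p hp => Or.inr (by linarith)
    have := hco.isOpen_inter_preimage (isOpen_Ioi.preimage continuous_fst) (isOpen_Ioi (a := 0))
    convert this using 1
    ext p
    simp
  obtain ⟨f, s, hf₁, hf₂⟩ := geometric_hahn_banach_open hconc.convex_strict_hypograph hopen
    hconv.convex_epigraph (by
      rw [Set.disjoint_left]
      rintro p ⟨h₁, h₂⟩ ⟨_, h₃⟩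
      have := h p.1 h₁
      linarith)
  set u := f (1, 0) with hu
  set v := f (0, 1) with hv
  have hf : ∀ x y : ℝ, f (x, y) = x * u + y * v := by
    intro x y
    have : ((x, y) : ℝ × ℝ) = x • (1, 0) + y • (0, 1) := by simp
    rw [this, map_add, map_smul, map_smul, smul_eq_mul, smul_eq_mul]
  have h₁ : ∀ w, c < w → ∀ y, y < 1 - (c / w) ^ α → w * u + y * v < s := by
    intro w hw y hy
    rw [← hf]; exact hf₁ (w, y) ⟨hw, hy⟩
  have h₂ : ∀ w y, ε + ε / V * (w - w₀) ^ 2 ≤ y → s ≤ w * u + y * v := by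
    intro w y hy
    rw [← hf]; exact hf₂ (w, y) ⟨trivial, hy⟩
  have hvpos : 0 < v := by
    have hlt := h₁ (c + 1) (by linarith) (1 - (c / (c + 1)) ^ α - 1) (by linarith)
    have hle := h₂ (c + 1) (ε + ε / V * (c + 1 - w₀) ^ 2) le_rfl
    have := h (c + 1) (by linarith)
    by_contra hv0
    nlinarith
  refine ⟨-u / v, (s - w₀ * u) / v, fun w hw => ?_, fun w => ?_⟩
  · refine le_of_forall_lt fun y hy => ?_
    have := h₁ w hw y hy
    have e : (s - w₀ * u) / v + -u / v * (w - w₀) = (s - w * u) / v := by ring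
    rw [e, lt_div_iff₀ hvpos]
    linarith
  · have := h₂ w _ le_rfl
    have e : (s - w₀ * u) / v + -u / v * (w - w₀) = (s - w * u) / v := by ring
    rw [e, div_le_iff₀ hvpos]
    linarith

theorem exists_quadratic_majorant {α ε c V w₀ : ℝ} (hα : 1 ≤ α) (hε : 0 < ε) (hc : 0 ≤ c)
    (hV : 0 < V) (h : ∀ w, c < w → 1 - (c / w) ^ α ≤ ε + ε / V * (w - w₀) ^ 2) :
    ∃ k₀ k₁ k₂ : ℝ, (∀ w, 0 ≤ k₀ + k₁ * w + k₂ * w ^ 2) ∧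
      (∀ w, c < w → 1 - (c / w) ^ α ≤ k₀ + k₁ * w + k₂ * w ^ 2) ∧
      k₀ + k₁ * w₀ + k₂ * (V + w₀ ^ 2) ≤ ε := by
  obtain ⟨A, l, hA, hQ⟩ := exists_line_between hα hε hc hV h
  have hd : A ^ 2 * V ≤ 4 * ε * (ε - l) := by
    have := discrim_le_zero (a := ε / V) (b := -A) (c := ε - l) (fun x => by
      have := hQ (x + w₀)
      simp only [add_sub_cancel_right] at this
      nlinarith)
    rw [discrim] at this
    have e : A ^ 2 ≤ 4 * ε * (ε - l) / V := by
      have : 4 * (ε / V) * (ε - l) = 4 * ε * (ε - l) / V := by ring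
      nlinarith
    rwa [le_div_iff₀ hV] at e
  have hl : 0 < 2 * ε - l := by
    have := hQ w₀
    simp at this
    linarith
  set d := 2 * ε - l with hd_def
  -- the majorant is `(L + d) ^ 2 / (4 * d)`, where `L` is the separating line
  have key : ∀ w, (l - A * w₀ + d) ^ 2 / (4 * d) + 2 * (l - A * w₀ + d) * A / (4 * d) * w
      + A ^ 2 / (4 * d) * w ^ 2 = (l + A * (w - w₀) + d) ^ 2 / (4 * d) := by
    intro w; ring
  refine ⟨(l - A * w₀ + d) ^ 2 / (4 * d), 2 * (l - A * w₀ + d) * A / (4 * d), A ^ 2 / (4 * d),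
    fun w => ?_, fun w hw => (hA w hw).trans ?_, ?_⟩
  · rw [key]; positivity
  · rw [key, le_div_iff₀ (by positivity)]
    nlinarith [sq_nonneg (l + A * (w - w₀) - d)]
  · have : (l - A * w₀ + d) ^ 2 / (4 * d) + 2 * (l - A * w₀ + d) * A / (4 * d) * w₀
      + A ^ 2 / (4 * d) * (V + w₀ ^ 2) = ((l + d) ^ 2 + A ^ 2 * V) / (4 * d) := by
      ring
    rw [this, div_le_iff₀ (by positivity)]
    have : l + d = 2 * ε := by rw [hd_def]; ring
    rw [this]
    nlinarith

theorem measurable_indicator_one_sub_rpow (α c : ℝ) :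
    Measurable ((Set.Ioi c).indicator fun x : ℝ => 1 - (c / x) ^ α) :=
  Measurable.indicator (by fun_prop) measurableSet_Ioi

theorem integrable_indicator_one_sub_rpow {α c : ℝ} (hα : 0 < α) (hc : 0 ≤ c) {Ω : Type*}
    [MeasurableSpace Ω] (ν : Measure Ω) [IsFiniteMeasure ν] {X : Ω → ℝ} (hX : Measurable X) :
    Integrable (fun ω => (Set.Ioi c).indicator (fun x : ℝ => 1 - (c / x) ^ α) (X ω)) ν := by
  refine Integrable.of_bound
    ((measurable_indicator_one_sub_rpow α c).comp hX).aestronglyMeasurable 1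
    (Filter.Eventually.of_forall fun ω => ?_)
  by_cases h : c < X ω
  · have h0 : 0 < X ω := hc.trans_lt h
    have h1 : (c / X ω) ^ α ≤ 1 :=
      Real.rpow_le_one (by positivity) ((div_le_one h0).2 h.le) hα.le
    have h2 : 0 ≤ (c / X ω) ^ α := by positivity
    rw [Set.indicator_of_mem (Set.mem_Ioi.2 h), Real.norm_eq_abs, abs_le]
    constructor <;> linarith
  · rw [Set.indicator_of_notMem (by simpa using h)]
    simp

theorem indicator_sub_dilation_ge {α c t : ℝ} (hα : 0 < α) (hc : 0 ≤ c) (ht : 0 < t) (ht1 : t < 1)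
    (x : ℝ) :
    (Set.Ioi (c / t)).indicator (fun _ => 1 - t ^ α) x ≤
      (Set.Ioi c).indicator (fun x : ℝ => 1 - (c / x) ^ α) x
        - t ^ α * (Set.Ioi c).indicator (fun x : ℝ => 1 - (c / x) ^ α) (t * x) := by
  have hiff : c / t < x ↔ c < t * x := by rw [div_lt_iff₀ ht, mul_comm]
  by_cases h : c / t < x
  · have htx := hiff.1 h
    have hx0 : 0 < x := (div_nonneg hc ht.le).trans_lt h
    have hx : c < x := htx.trans (by nlinarith)
    rw [Set.indicator_of_mem (Set.mem_Ioi.2 h), Set.indicator_of_mem (Set.mem_Ioi.2 hx),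
      Set.indicator_of_mem (Set.mem_Ioi.2 htx)]
    have : t ^ α * (c / (t * x)) ^ α = (c / x) ^ α := by
      rw [← Real.mul_rpow ht.le (by positivity)]
      congr 1
      field_simp
    linarith
  · have htx : ¬ c < t * x := fun h' => h (hiff.2 h')
    rw [Set.indicator_of_notMem (by simpa using h),
      Set.indicator_of_notMem (show t * x ∉ Set.Ioi c from htx), mul_zero, sub_zero]
    refine Set.indicator_nonneg (fun y hy => ?_) x
    have hy0 : 0 < y := hc.trans_lt hy
    have : (c / y) ^ α ≤ 1 :=
      Real.rpow_le_one (by positivity) ((div_le_one hy0).2 (le_of_lt hy)) hα.le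
    linarith

theorem tendsto_one_sub_rpow_div {α β : ℝ} (hα : 0 < α) :
    Filter.Tendsto (fun t : ℝ => (1 - t ^ β) / (1 - t ^ α)) (nhdsWithin 1 (Set.Iio 1))
      (nhds (β / α)) := by
  have key : ∀ γ : ℝ, Filter.Tendsto (slope (fun t : ℝ => t ^ γ) 1) (nhdsWithin 1 (Set.Iio 1))
      (nhds γ) := by
    intro γ
    have h := (Real.hasDerivAt_rpow_const (x := 1) (p := γ) (Or.inl one_ne_zero)).tendsto_slope
    simp only [Real.one_rpow, mul_one] at h
    exact h.mono_left (nhdsWithin_mono _ fun x hx => ne_of_lt hx)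
  refine ((key β).div (key α) hα.ne').congr' ?_
  filter_upwards [self_mem_nhdsWithin] with t ht
  have ht' : t - 1 ≠ 0 := sub_ne_zero.2 (ne_of_lt ht)
  simp only [slope_def_field, Real.one_rpow, Pi.div_apply]
  rw [div_div_div_cancel_right₀ ht', ← neg_sub, ← neg_sub (1 : ℝ), neg_div_neg_eq]

section tail

variable {ν : Measure ℝ}

theorem tail_le_of_dilation_le [IsProbabilityMeasure ν] {α c t k₀ k₁ k₂ : ℝ} (hα : 0 < α)
    (hc : 0 ≤ c) (ht : 0 < t) (ht1 : t < 1)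
    (hν : ENNReal.ofReal (t ^ α) • ν.map (fun x => t * x) ≤ ν)
    (h₁ : Integrable (fun x => x) ν) (h₂ : Integrable (fun x => x ^ 2) ν)
    (hq : ∀ x, 0 ≤ k₀ + k₁ * x + k₂ * x ^ 2)
    (hqf : ∀ x, c < x → 1 - (c / x) ^ α ≤ k₀ + k₁ * x + k₂ * x ^ 2) :
    (1 - t ^ α) * ν.real (Set.Ioi (c / t)) ≤ (1 - t ^ α) * k₀
      + k₁ * ((1 - t ^ (α + 1)) * ∫ x, x ∂ν) + k₂ * ((1 - t ^ (α + 2)) * ∫ x, x ^ 2 ∂ν) := by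
  set f : ℝ → ℝ := (Set.Ioi c).indicator fun x : ℝ => 1 - (c / x) ^ α with hf
  set φ : ℝ → ℝ := fun x => k₀ + k₁ * x + k₂ * x ^ 2 - f x with hφ
  have hfm : Measurable f := measurable_indicator_one_sub_rpow α c
  have hφm : Measurable φ := by fun_prop
  have hφ0 : ∀ x, 0 ≤ φ x := by
    intro x
    by_cases h : c < x
    · have := hqf x h
      simp only [hφ, hf, Set.indicator_of_mem (Set.mem_Ioi.2 h)]
      linarith
    · simp only [hφ, hf, Set.indicator_of_notMem (show x ∉ Set.Ioi c from h), sub_zero]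
      exact hq x
  have hfi : Integrable f ν := integrable_indicator_one_sub_rpow hα hc ν measurable_id
  have hfti : Integrable (fun x => f (t * x)) ν :=
    integrable_indicator_one_sub_rpow hα hc ν (measurable_const_mul t)
  have hφi : Integrable φ ν :=
    (((integrable_const k₀).add (h₁.const_mul k₁)).add (h₂.const_mul k₂)).sub hfi
  have hφti : Integrable (fun x => φ (t * x)) ν := by
    have := (((integrable_const (μ := ν) k₀).add (h₁.const_mul (k₁ * t))).add
      (h₂.const_mul (k₂ * t ^ 2))).sub hfti
    refine this.congr (Filter.Eventually.of_forall fun x => ?_)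
    simp only [hφ, Pi.add_apply, Pi.sub_apply]
    ring
  have hmono := integral_mono_measure hν (Filter.Eventually.of_forall hφ0) hφi
  rw [integral_smul_measure, ENNReal.toReal_ofReal (by positivity),
    integral_map (by fun_prop) hφm.aestronglyMeasurable, smul_eq_mul] at hmono
  have hlin : ∀ A B : ℝ, Integrable (fun x => A + B * x) ν :=
    fun A B => (integrable_const A).add (h₁.const_mul B)
  have hquad : ∀ A B C : ℝ, Integrable (fun x => A + B * x + C * x ^ 2) ν :=
    fun A B C => (hlin A B).add (h₂.const_mul C)
  have hind : Integrable ((Set.Ioi (c / t)).indicator fun _ => 1 - t ^ α) ν :=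
    (integrable_const _).indicator measurableSet_Ioi
  have hle : ∫ x, φ x - t ^ α * φ (t * x) ∂ν ≤
      ∫ x, ((1 - t ^ α) * k₀ + (k₁ * (1 - t ^ (α + 1))) * x + (k₂ * (1 - t ^ (α + 2))) * x ^ 2
        - (Set.Ioi (c / t)).indicator (fun _ => 1 - t ^ α) x) ∂ν := by
    refine integral_mono (hφi.sub (hφti.const_mul _))
      ((hquad _ _ _).sub hind) fun x => ?_
    have := indicator_sub_dilation_ge hα hc ht ht1 x
    rw [← hf] at this
    simp only [hφ]
    rw [Real.rpow_add ht, Real.rpow_add ht, Real.rpow_one,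
      show (t : ℝ) ^ (2 : ℝ) = t ^ 2 from Real.rpow_natCast t 2]
    linarith
  rw [integral_sub hφi (hφti.const_mul _), integral_const_mul,
    integral_sub (hquad _ _ _) hind, integral_add (hlin _ _) (h₂.const_mul _),
    integral_add (integrable_const _) (h₁.const_mul _), integral_const_mul, integral_const_mul,
    integral_const_mul, integral_indicator measurableSet_Ioi, setIntegral_const, integral_const] at hle
  simp only [probReal_univ, smul_eq_mul, one_mul] at hle
  linarith

theorem one_sub_le_cdf_of_dilation_le [IsProbabilityMeasure ν] {α c k₀ k₁ k₂ : ℝ} (hα : 0 < α)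
    (hc : 0 ≤ c)
    (hν : ∀ t : ℝ, 0 < t → t < 1 → ENNReal.ofReal (t ^ α) • ν.map (fun x => t * x) ≤ ν)
    (h₁ : Integrable (fun x => x) ν) (h₂ : Integrable (fun x => x ^ 2) ν)
    (hq : ∀ x, 0 ≤ k₀ + k₁ * x + k₂ * x ^ 2)
    (hqf : ∀ x, c < x → 1 - (c / x) ^ α ≤ k₀ + k₁ * x + k₂ * x ^ 2) :
    1 - (k₀ + k₁ * ((α + 1) / α * ∫ x, x ∂ν) + k₂ * ((α + 2) / α * ∫ x, x ^ 2 ∂ν)) ≤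
      ν.real (Set.Iic c) := by
  rw [← ProbabilityTheory.cdf_eq_real]
  have hct : Filter.Tendsto (fun t : ℝ => c / t) (nhdsWithin 1 (Set.Iio 1))
      (nhdsWithin c (Set.Ici c)) := by
    refine tendsto_nhdsWithin_iff.2 ⟨?_, ?_⟩
    · have : ContinuousAt (fun t : ℝ => c / t) 1 := continuousAt_const.div continuousAt_id one_ne_zero
      have h := this.tendsto
      rw [div_one] at h
      exact h.mono_left nhdsWithin_le_nhds
    · filter_upwards [Ioo_mem_nhdsLT (zero_lt_one (α := ℝ))] with t ht
      rw [Set.mem_Ici, le_div_iff₀ ht.1]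
      nlinarith [ht.2]
  have hlim := (((ProbabilityTheory.cdf ν).right_continuous c).tendsto).comp hct
  have hlhs := (((((tendsto_one_sub_rpow_div (β := α + 1) hα).mul_const (∫ x, x ∂ν)).const_mul
    k₁).const_add k₀).add (((tendsto_one_sub_rpow_div (β := α + 2) hα).mul_const
    (∫ x, x ^ 2 ∂ν)).const_mul k₂)).const_sub 1
  refine le_of_tendsto_of_tendsto hlhs hlim ?_
  filter_upwards [Ioo_mem_nhdsLT (zero_lt_one (α := ℝ))] with t ht
  have key := tail_le_of_dilation_le hα hc ht.1 ht.2 (hν t ht.1 ht.2) h₁ h₂ hq hqf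
  have hpos : 0 < 1 - t ^ α := sub_pos.2 (Real.rpow_lt_one ht.1.le ht.2 hα)
  have hcompl : ν.real (Set.Ioi (c / t)) = 1 - ν.real (Set.Iic (c / t)) := by
    rw [← Set.compl_Iic, probReal_compl_eq_one_sub measurableSet_Iic]
  simp only [Function.comp, ProbabilityTheory.cdf_eq_real]
  rw [hcompl] at key
  have e : k₀ + k₁ * ((1 - t ^ (α + 1)) / (1 - t ^ α) * ∫ x, x ∂ν)
      + k₂ * ((1 - t ^ (α + 2)) / (1 - t ^ α) * ∫ x, x ^ 2 ∂ν)
      = ((1 - t ^ α) * k₀ + k₁ * ((1 - t ^ (α + 1)) * ∫ x, x ∂ν)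
        + k₂ * ((1 - t ^ (α + 2)) * ∫ x, x ^ 2 ∂ν)) / (1 - t ^ α) := by
    field_simp
  rw [e, sub_le_comm, le_div_iff₀ hpos]
  linarith

end tail

/-- The Cantelli-type condition over all levels `τ` says that the tail function lies below a
parabola. -/
theorem one_sub_rpow_le_of_forall_level {α ε c V w₀ : ℝ} (hα : 0 < α) (hε : 0 < ε) (hε1 : ε < 1)
    (hc : 0 ≤ c) (hV : 0 < V)
    (h : ∀ τ : ℝ, (1 / (1 - ε)) ^ (1 / α) ≤ τ →
      Real.sqrt ((1 - ε - τ ^ (-α)) / ε) * Real.sqrt V ≤ τ * c - w₀) :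
    ∀ w, c < w → 1 - (c / w) ^ α ≤ ε + ε / V * (w - w₀) ^ 2 := by
  have hsq : ∀ τ : ℝ, (1 / (1 - ε)) ^ (1 / α) ≤ τ →
      0 ≤ τ * c - w₀ ∧ 1 - τ ^ (-α) ≤ ε + ε / V * (τ * c - w₀) ^ 2 := by
    intro τ hτ
    have h₁ := h τ hτ
    have h₀ : 0 ≤ τ * c - w₀ := le_trans (by positivity) h₁
    refine ⟨h₀, ?_⟩
    rw [← Real.sqrt_mul' _ hV.le, Real.sqrt_le_left h₀] at h₁
    have e : 1 - τ ^ (-α) = ε + ε / V * ((1 - ε - τ ^ (-α)) / ε * V) := by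
      field_simp; ring
    rw [e]
    gcongr
  intro w hw
  have hw0 : 0 < w := hc.trans_lt hw
  have hpar : 0 ≤ ε / V * (w - w₀) ^ 2 := by positivity
  rcases hc.eq_or_lt with rfl | hc0
  · simp only [mul_zero, zero_sub] at hsq
    have hlim : Filter.Tendsto (fun τ : ℝ => 1 - τ ^ (-α)) Filter.atTop (nhds (1 - 0)) :=
      (tendsto_rpow_neg_atTop hα).const_sub 1
    have hle : 1 - 0 ≤ ε + ε / V * (-w₀) ^ 2 := le_of_tendsto hlim
      ((Filter.eventually_ge_atTop _).mono fun τ hτ => (hsq τ hτ).2)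
    have hw₀ := (hsq _ le_rfl).1
    rw [zero_div, Real.zero_rpow hα.ne']
    refine hle.trans ?_
    gcongr
    linarith
  · by_cases hg : 1 - (c / w) ^ α ≤ ε
    · linarith
    · have hτ0 : 0 < w / c := by positivity
      have hτα : (w / c) ^ (-α) = (c / w) ^ α := by
        rw [Real.rpow_neg hτ0.le, ← Real.inv_rpow hτ0.le, inv_div]
      have hτ : (1 / (1 - ε)) ^ (1 / α) ≤ w / c := by
        have h1 : 1 / (1 - ε) ≤ (w / c) ^ α := by
          rw [← inv_div c w, Real.inv_rpow (by positivity), ← one_div]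
          exact one_div_le_one_div_of_le (by positivity) (by linarith)
        calc (1 / (1 - ε)) ^ (1 / α) ≤ ((w / c) ^ α) ^ (1 / α) :=
              Real.rpow_le_rpow (one_div_nonneg.2 (by linarith)) h1 (by positivity)
          _ = w / c := by rw [one_div, Real.rpow_rpow_inv hτ0.le hα.ne']
      have := (hsq _ hτ).2
      rwa [hτα, div_mul_cancel₀ _ hc0.ne'] at this

section unimodal

variable {n : ℕ} {P : Measure (Fin n → ℝ)}

theorem measurable_dotProduct_sub (a m : Fin n → ℝ) :
    Measurable fun ξ : Fin n → ℝ => a ⬝ᵥ (ξ - m) := by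
  unfold dotProduct
  fun_prop

theorem AlphaUnimodal.dilation_map_le [IsProbabilityMeasure P] {α : ℝ} {m : Fin n → ℝ}
    (hP : AlphaUnimodal α m P) (a : Fin n → ℝ) {t : ℝ} (ht : 0 < t) (ht1 : t < 1) :
    ENNReal.ofReal (t ^ α) • (P.map fun ξ => a ⬝ᵥ (ξ - m)).map (fun x => t * x) ≤
      P.map fun ξ => a ⬝ᵥ (ξ - m) := by
  rw [Measure.le_iff]
  intro A hA
  have hX := measurable_dotProduct_sub a m
  have ht_meas : Measurable fun x : ℝ => t * x := measurable_const_mul t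
  have hdot : Measurable fun x : Fin n → ℝ => a ⬝ᵥ x := by
    simpa using measurable_dotProduct_sub a 0
  have hsub : Measurable fun ξ : Fin n → ℝ => ξ - m := measurable_id.sub_const m
  have hset : (1 / t) • ((fun x : Fin n → ℝ => a ⬝ᵥ x) ⁻¹' A) =
      (fun x : Fin n → ℝ => a ⬝ᵥ x) ⁻¹' ((fun x => t * x) ⁻¹' A) := by
    ext x
    rw [Set.mem_smul_set_iff_inv_smul_mem₀ (by positivity)]
    simp [dotProduct_smul]
  have hmono := hP _ (hdot hA) (Set.mem_Ioi.2 ht) (Set.mem_Ioi.2 zero_lt_one) ht1.le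
  simp only [Real.one_rpow, one_mul, div_one, one_smul] at hmono
  rw [hset, Measure.map_apply hsub (hdot (ht_meas hA)), Measure.map_apply hsub (hdot hA)] at hmono
  rw [Measure.smul_apply, smul_eq_mul, Measure.map_apply ht_meas hA,
    Measure.map_apply hX (ht_meas hA), Measure.map_apply hX hA]
  rw [← ENNReal.ofReal_toReal (measure_ne_top P ((fun ξ => a ⬝ᵥ (ξ - m)) ⁻¹' A)),
    ← ENNReal.ofReal_toReal (measure_ne_top P (_ ⁻¹' ((fun x => t * x) ⁻¹' A))),
    ← ENNReal.ofReal_mul (by positivity)]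
  exact ENNReal.ofReal_le_ofReal hmono

theorem dotProduct_sub_sq (a ξ m : Fin n → ℝ) :
    (a ⬝ᵥ (ξ - m)) ^ 2 = (∑ i, ∑ j, a i * a j * (ξ i * ξ j)) - 2 * (a ⬝ᵥ m) * (a ⬝ᵥ ξ)
      + (a ⬝ᵥ m) ^ 2 := by
  have : ∑ i, ∑ j, a i * a j * (ξ i * ξ j) = (a ⬝ᵥ ξ) ^ 2 := by
    rw [sq, dotProduct, Finset.sum_mul_sum]
    exact Finset.sum_congr rfl fun i _ => Finset.sum_congr rfl fun j _ => by ring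
  rw [this, dotProduct_sub]
  ring

theorem integrable_dotProduct (h₁ : ∀ i, Integrable (fun ξ => ξ i) P) (a : Fin n → ℝ) :
    Integrable (fun ξ => a ⬝ᵥ ξ) P :=
  integrable_finsetSum _ fun i _ => (h₁ i).const_mul (a i)

theorem integrable_dotProduct_sub [IsFiniteMeasure P] (h₁ : ∀ i, Integrable (fun ξ => ξ i) P)
    (a m : Fin n → ℝ) : Integrable (fun ξ => a ⬝ᵥ (ξ - m)) P := by
  simp only [dotProduct_sub]
  exact (integrable_dotProduct h₁ a).sub (integrable_const _)

theorem integrable_sum_mul_mul (h₂ : ∀ i j, Integrable (fun ξ => ξ i * ξ j) P) (a : Fin n → ℝ) :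
    Integrable (fun ξ : Fin n → ℝ => ∑ i, ∑ j, a i * a j * (ξ i * ξ j)) P :=
  integrable_finsetSum _ fun i _ => integrable_finsetSum _ fun j _ => (h₂ i j).const_mul _

theorem integrable_dotProduct_sub_sq [IsFiniteMeasure P] (h₁ : ∀ i, Integrable (fun ξ => ξ i) P)
    (h₂ : ∀ i j, Integrable (fun ξ => ξ i * ξ j) P) (a m : Fin n → ℝ) :
    Integrable (fun ξ => (a ⬝ᵥ (ξ - m)) ^ 2) P := by
  simp only [dotProduct_sub_sq]
  exact ((integrable_sum_mul_mul h₂ a).sub ((integrable_dotProduct h₁ a).const_mul _)).add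
    (integrable_const _)

theorem integral_dotProduct {μ : Fin n → ℝ} (h₁ : ∀ i, Integrable (fun ξ => ξ i) P)
    (hμ : ∀ i, (∫ ξ, ξ i ∂P) = μ i) (a : Fin n → ℝ) : ∫ ξ, a ⬝ᵥ ξ ∂P = a ⬝ᵥ μ := by
  simp only [dotProduct]
  rw [integral_finsetSum _ fun i _ => (h₁ i).const_mul (a i)]
  simp only [integral_const_mul, hμ]

theorem integral_sum_mul_mul {S : Matrix (Fin n) (Fin n) ℝ}
    (h₂ : ∀ i j, Integrable (fun ξ => ξ i * ξ j) P)
    (hS : ∀ i j, (∫ ξ, ξ i * ξ j ∂P) = S i j) (a : Fin n → ℝ) :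
    ∫ ξ, ∑ i, ∑ j, a i * a j * (ξ i * ξ j) ∂P = a ⬝ᵥ S *ᵥ a := by
  rw [integral_finsetSum _ fun i _ => integrable_finsetSum _ fun j _ => (h₂ i j).const_mul _]
  simp only [dotProduct, mulVec, Finset.mul_sum]
  refine Finset.sum_congr rfl fun i _ => ?_
  rw [integral_finsetSum _ fun j _ => (h₂ i j).const_mul _]
  refine Finset.sum_congr rfl fun j _ => ?_
  rw [integral_const_mul, hS]
  ring

theorem integral_dotProduct_sub [IsProbabilityMeasure P] {μ : Fin n → ℝ}
    (h₁ : ∀ i, Integrable (fun ξ => ξ i) P) (hμ : ∀ i, (∫ ξ, ξ i ∂P) = μ i) (a m : Fin n → ℝ) :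
    ∫ ξ, a ⬝ᵥ (ξ - m) ∂P = a ⬝ᵥ μ - a ⬝ᵥ m := by
  simp only [dotProduct_sub]
  rw [integral_sub (integrable_dotProduct h₁ a) (integrable_const _),
    integral_dotProduct h₁ hμ]
  simp

theorem integral_dotProduct_sub_sq [IsProbabilityMeasure P] {μ : Fin n → ℝ}
    {S : Matrix (Fin n) (Fin n) ℝ} (h₁ : ∀ i, Integrable (fun ξ => ξ i) P)
    (h₂ : ∀ i j, Integrable (fun ξ => ξ i * ξ j) P) (hμ : ∀ i, (∫ ξ, ξ i ∂P) = μ i)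
    (hS : ∀ i j, (∫ ξ, ξ i * ξ j ∂P) = S i j) (a m : Fin n → ℝ) :
    ∫ ξ, (a ⬝ᵥ (ξ - m)) ^ 2 ∂P =
      a ⬝ᵥ S *ᵥ a - 2 * (a ⬝ᵥ m) * (a ⬝ᵥ μ) + (a ⬝ᵥ m) ^ 2 := by
  have hlin := (integrable_dotProduct h₁ a).const_mul (2 * (a ⬝ᵥ m))
  have hsub : Integrable (fun ξ : Fin n → ℝ =>
      ∑ i, ∑ j, a i * a j * (ξ i * ξ j) - 2 * (a ⬝ᵥ m) * (a ⬝ᵥ ξ)) P :=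
    (integrable_sum_mul_mul h₂ a).sub hlin
  simp only [dotProduct_sub_sq]
  rw [integral_add hsub (integrable_const _), integral_sub (integrable_sum_mul_mul h₂ a) hlin,
    integral_const_mul, integral_dotProduct h₁ hμ, integral_sum_mul_mul h₂ hS]
  simp

theorem dotProduct_mulVec_sq_eq {α : ℝ} {μ m : Fin n → ℝ} {S L : Matrix (Fin n) (Fin n) ℝ}
    (hL : L.PosSemidef)
    (hLsq : L * L = ((α + 2) / α) • (S - vecMulVec μ μ)
        - (1 / α ^ 2) • vecMulVec (μ - m) (μ - m)) (a : Fin n → ℝ) :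
    (L *ᵥ a) ⬝ᵥ (L *ᵥ a) = (α + 2) / α * (a ⬝ᵥ S *ᵥ a - (a ⬝ᵥ μ) ^ 2)
      - 1 / α ^ 2 * (a ⬝ᵥ μ - a ⬝ᵥ m) ^ 2 := by
  have hT : Lᵀ = L := by simpa using hL.isHermitian.eq
  have : (L *ᵥ a) ⬝ᵥ (L *ᵥ a) = a ⬝ᵥ (L * L) *ᵥ a := by
    rw [← mulVec_mulVec, dotProduct_mulVec a, ← mulVec_transpose, hT]
  rw [this, hLsq]
  simp only [sub_mulVec, smul_mulVec, dotProduct_sub, dotProduct_smul, smul_eq_mul,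
    vecMulVec_mulVec, op_smul_eq_smul, dotProduct_comm _ a]
  ring

theorem AlphaUnimodal.prob_halfspace_ge [IsProbabilityMeasure P] {α ε b : ℝ} {μ m a : Fin n → ℝ}
    {S L : Matrix (Fin n) (Fin n) ℝ} (hP : AlphaUnimodal α m P) (hα : 1 ≤ α) (hε : 0 < ε)
    (hε1 : ε < 1) (h₁ : ∀ i, Integrable (fun ξ => ξ i) P)
    (h₂ : ∀ i j, Integrable (fun ξ => ξ i * ξ j) P) (hμ : ∀ i, (∫ ξ, ξ i ∂P) = μ i)
    (hS : ∀ i j, (∫ ξ, ξ i * ξ j ∂P) = S i j) (hm : a ⬝ᵥ m ≤ b) (hL : L.PosSemidef)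
    (hLsq : L * L = ((α + 2) / α) • (S - vecMulVec μ μ)
        - (1 / α ^ 2) • vecMulVec (μ - m) (μ - m))
    (hpos : 0 < (L *ᵥ a) ⬝ᵥ (L *ᵥ a))
    (h : ∀ τ : ℝ, (1 / (1 - ε)) ^ (1 / α) ≤ τ →
      Real.sqrt ((1 - ε - τ ^ (-α)) / ε) * Real.sqrt ((L *ᵥ a) ⬝ᵥ (L *ᵥ a)) ≤
        τ * (b - μ ⬝ᵥ a) + (τ - (α + 1) / α) * ((μ - m) ⬝ᵥ a)) :
    ENNReal.ofReal (1 - ε) ≤ P {ξ | a ⬝ᵥ ξ ≤ b} := by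
  have hα0 : 0 < α := by linarith
  have hc : 0 ≤ b - a ⬝ᵥ m := sub_nonneg.2 hm
  set w₀ := (α + 1) / α * (a ⬝ᵥ μ - a ⬝ᵥ m) with hw₀
  have hbelow := one_sub_rpow_le_of_forall_level (w₀ := w₀) hα0 hε hε1 hc hpos fun τ hτ => by
    refine (h τ hτ).trans_eq ?_
    rw [sub_dotProduct, dotProduct_comm μ, dotProduct_comm m, hw₀]
    ring
  obtain ⟨k₀, k₁, k₂, hq, hqf, hk⟩ := exists_quadratic_majorant hα hε hc hpos hbelow
  have hX := measurable_dotProduct_sub a m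
  have : IsProbabilityMeasure (P.map fun ξ => a ⬝ᵥ (ξ - m)) :=
    Measure.isProbabilityMeasure_map hX.aemeasurable
  have key := one_sub_le_cdf_of_dilation_le (ν := P.map fun ξ => a ⬝ᵥ (ξ - m)) hα0 hc
    (fun t ht ht1 => hP.dilation_map_le a ht ht1)
    ((integrable_map_measure (by fun_prop) hX.aemeasurable).2
      (integrable_dotProduct_sub h₁ a m))
    ((integrable_map_measure (by fun_prop) hX.aemeasurable).2
      (integrable_dotProduct_sub_sq h₁ h₂ a m)) hq hqf
  rw [integral_map hX.aemeasurable (by fun_prop), integral_map hX.aemeasurable (by fun_prop),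
    integral_dotProduct_sub h₁ hμ, integral_dotProduct_sub_sq h₁ h₂ hμ hS,
    map_measureReal_apply hX measurableSet_Iic] at key
  have hV : (L *ᵥ a) ⬝ᵥ (L *ᵥ a) + w₀ ^ 2 = (α + 2) / α *
      (a ⬝ᵥ S *ᵥ a - 2 * (a ⬝ᵥ m) * (a ⬝ᵥ μ) + (a ⬝ᵥ m) ^ 2) := by
    rw [dotProduct_mulVec_sq_eq hL hLsq, hw₀]
    field_simp
    ring
  rw [← hV, ← hw₀] at key
  have hset : (fun ξ => a ⬝ᵥ (ξ - m)) ⁻¹' Set.Iic (b - a ⬝ᵥ m) = {ξ | a ⬝ᵥ ξ ≤ b} := by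
    ext ξ
    simp [dotProduct_sub]
  rw [hset] at key
  exact ENNReal.ofReal_le_of_le_toReal (by
    change 1 - ε ≤ P.real _
    linarith)

end unimodal

/-- The law of `m + U ^ (1 / α) • Z`, where `U` is uniform on `(0, 1]` and `Z` is independent of
`U` and takes the value `z j` with probability `w j`. -/
noncomputable def rayMixture {J : Type*} [Fintype J] {n : ℕ} (α : ℝ) (m : Fin n → ℝ) (w : J → ℝ)
    (z : J → Fin n → ℝ) : Measure (Fin n → ℝ) :=
  ∑ j, ENNReal.ofReal (w j) •
    (volume.restrict (Set.Ioc (0 : ℝ) 1)).map fun u : ℝ => m + u ^ (1 / α) • z j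

section rayMixture

variable {J : Type*} [Fintype J] {n : ℕ} {α : ℝ} {m : Fin n → ℝ} {w : J → ℝ} {z : J → Fin n → ℝ}

theorem measurable_ray (α : ℝ) (m v : Fin n → ℝ) :
    Measurable fun u : ℝ => m + u ^ (1 / α) • v := by
  refine measurable_pi_iff.2 fun i => ?_
  simp only [Pi.add_apply, Pi.smul_apply, smul_eq_mul]
  fun_prop

theorem rayMixture_apply {A : Set (Fin n → ℝ)} (hA : MeasurableSet A) :
    rayMixture α m w z A = ∑ j, ENNReal.ofReal (w j) *
      volume ({u : ℝ | m + u ^ (1 / α) • z j ∈ A} ∩ Set.Ioc 0 1) := by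
  rw [rayMixture, Measure.finsetSum_apply]
  refine Finset.sum_congr rfl fun j _ => ?_
  rw [Measure.smul_apply, smul_eq_mul, Measure.map_apply (measurable_ray _ _ _) hA,
    Measure.restrict_apply (measurable_ray _ _ _ hA)]
  rfl

theorem isProbabilityMeasure_rayMixture (hw : ∀ j, 0 ≤ w j) (hw1 : ∑ j, w j = 1) :
    IsProbabilityMeasure (rayMixture α m w z) := by
  constructor
  rw [rayMixture_apply MeasurableSet.univ]
  simp only [Set.mem_univ, Set.ofPred_true, Set.univ_inter, Real.volume_Ioc, sub_zero,
    ENNReal.ofReal_one, mul_one]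
  rw [← ENNReal.ofReal_sum_of_nonneg fun j _ => hw j, hw1, ENNReal.ofReal_one]

theorem ofReal_rpow_mul_volume_ray (hα : 0 < α) (v : Fin n → ℝ) (B : Set (Fin n → ℝ)) {t : ℝ}
    (ht : 0 < t) :
    ENNReal.ofReal (t ^ α) *
        volume ({u : ℝ | u ^ (1 / α) • v ∈ (1 / t) • B} ∩ Set.Ioc 0 1) =
      volume ({u : ℝ | u ^ (1 / α) • v ∈ B} ∩ Set.Ioc 0 (t ^ α)) := by
  have htα : 0 < t ^ α := by positivity
  have hset : {u : ℝ | u ^ (1 / α) • v ∈ (1 / t) • B} ∩ Set.Ioc 0 1 =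
      (fun u => t ^ α * u) ⁻¹' ({u : ℝ | u ^ (1 / α) • v ∈ B} ∩ Set.Ioc 0 (t ^ α)) := by
    ext u
    simp only [Set.mem_inter_iff, Set.mem_ofPred_eq, Set.mem_Ioc, Set.mem_preimage,
      mul_pos_iff_of_pos_left htα, mul_le_iff_le_one_right htα]
    refine and_congr_left fun hu => ?_
    rw [Set.mem_smul_set_iff_inv_smul_mem₀ (by positivity), one_div, inv_inv, smul_smul,
      Real.mul_rpow htα.le hu.1.le, one_div, Real.rpow_rpow_inv ht.le hα.ne']
  rw [hset, Real.volume_preimage_mul_left htα.ne', ← mul_assoc,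
    ← ENNReal.ofReal_mul htα.le, abs_of_pos (inv_pos.2 htα), mul_inv_cancel₀ htα.ne',
    ENNReal.ofReal_one, one_mul]

theorem alphaUnimodal_rayMixture (hα : 0 < α) (hw : ∀ j, 0 ≤ w j) (hw1 : ∑ j, w j = 1) :
    AlphaUnimodal α m (rayMixture α m w z) := by
  have := isProbabilityMeasure_rayMixture (α := α) (m := m) (z := z) hw hw1
  intro B hB
  have key : ∀ t : ℝ, 0 < t →
      t ^ α * (((rayMixture α m w z).map fun x => x - m) ((1 / t) • B)).toReal =
      (∑ j, ENNReal.ofReal (w j) *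
        volume ({u : ℝ | u ^ (1 / α) • z j ∈ B} ∩ Set.Ioc 0 (t ^ α))).toReal := by
    intro t ht
    have hBt : MeasurableSet ((1 / t) • B) := hB.const_smul₀ _
    have hsub : Measurable fun x : Fin n → ℝ => x - m := measurable_id.sub_const m
    rw [Measure.map_apply hsub hBt, rayMixture_apply (hsub hBt)]
    rw [← ENNReal.toReal_ofReal (show 0 ≤ t ^ α by positivity), ← ENNReal.toReal_mul,
      Finset.mul_sum, ENNReal.toReal_ofReal (show 0 ≤ t ^ α by positivity)]
    congr 1
    refine Finset.sum_congr rfl fun j _ => ?_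
    rw [← ofReal_rpow_mul_volume_ray hα _ _ ht, mul_left_comm]
    simp
  intro s hs t ht hst
  simp only
  rw [key s hs, key t ht]
  refine ENNReal.toReal_mono ?_ ?_
  · refine (ENNReal.sum_lt_top.2 fun j _ => ENNReal.mul_lt_top ENNReal.ofReal_lt_top ?_).ne
    exact (measure_mono Set.inter_subset_right).trans_lt measure_Ioc_lt_top
  · have hs0 : 0 < s := hs
    gcongr

theorem integrable_rayMixture {F : (Fin n → ℝ) → ℝ} (hF : Measurable F)
    (h : ∀ j, IntegrableOn (fun u : ℝ => F (m + u ^ (1 / α) • z j)) (Set.Ioc 0 1)) :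
    Integrable F (rayMixture α m w z) := by
  rw [rayMixture, integrable_finsetSum_measure]
  intro j _
  refine Integrable.smul_measure ?_ ENNReal.ofReal_ne_top
  exact (integrable_map_measure hF.aestronglyMeasurable
    (measurable_ray _ _ _).aemeasurable).2 (h j)

theorem integral_rayMixture (hw : ∀ j, 0 ≤ w j) {F : (Fin n → ℝ) → ℝ} (hF : Measurable F)
    (h : ∀ j, IntegrableOn (fun u : ℝ => F (m + u ^ (1 / α) • z j)) (Set.Ioc 0 1)) :
    ∫ ξ, F ξ ∂(rayMixture α m w z) =
      ∑ j, w j * ∫ u in Set.Ioc (0 : ℝ) 1, F (m + u ^ (1 / α) • z j) := by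
  rw [rayMixture, integral_finsetSum_measure]
  · refine Finset.sum_congr rfl fun j _ => ?_
    rw [integral_smul_measure, ENNReal.toReal_ofReal (hw j), smul_eq_mul,
      integral_map (measurable_ray _ _ _).aemeasurable hF.aestronglyMeasurable]
  · intro j _
    refine Integrable.smul_measure ?_ ENNReal.ofReal_ne_top
    exact (integrable_map_measure hF.aestronglyMeasurable
      (measurable_ray _ _ _).aemeasurable).2 (h j)

theorem integrableOn_rpow_Ioc {r : ℝ} (hr : 0 < r) :
    IntegrableOn (fun u : ℝ => u ^ r) (Set.Ioc 0 1) :=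
  (intervalIntegrable_iff_integrableOn_Ioc_of_le zero_le_one).1
    (intervalIntegral.intervalIntegrable_rpow (Or.inl hr.le))

theorem integral_rpow_Ioc {r : ℝ} (hr : 0 < r) :
    ∫ u in Set.Ioc (0 : ℝ) 1, u ^ r = 1 / (r + 1) := by
  rw [← intervalIntegral.integral_of_le zero_le_one, integral_rpow (Or.inl (by linarith)),
    Real.one_rpow, Real.zero_rpow (by linarith), sub_zero]

theorem integrableOn_affine_rpow (hα : 0 < α) (A B C : ℝ) :
    IntegrableOn (fun u : ℝ => A + B * u ^ (1 / α) + C * u ^ (2 / α)) (Set.Ioc 0 1) :=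
  ((integrable_const A).add ((integrableOn_rpow_Ioc (by positivity)).const_mul B)).add
    ((integrableOn_rpow_Ioc (by positivity)).const_mul C)

theorem integral_affine_rpow (hα : 0 < α) (A B C : ℝ) :
    ∫ u in Set.Ioc (0 : ℝ) 1, (A + B * u ^ (1 / α) + C * u ^ (2 / α)) =
      A + B * (α / (α + 1)) + C * (α / (α + 2)) := by
  have h₁ := (integrableOn_rpow_Ioc (r := 1 / α) (by positivity)).const_mul B
  have h₂ := (integrableOn_rpow_Ioc (r := 2 / α) (by positivity)).const_mul C
  have h₀ : IntegrableOn (fun u : ℝ => A + B * u ^ (1 / α)) (Set.Ioc 0 1) :=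
    (integrable_const A).add h₁
  rw [integral_add h₀ h₂, integral_add (integrable_const A) h₁, integral_const_mul,
    integral_const_mul, integral_rpow_Ioc (by positivity), integral_rpow_Ioc (by positivity)]
  simp
  field_simp
  ring

theorem eqOn_ray_mul (α : ℝ) (m v : Fin n → ℝ) (i k : Fin n) :
    Set.EqOn (fun u : ℝ => m i * m k + (m i * v k + m k * v i) * u ^ (1 / α)
        + v i * v k * u ^ (2 / α))
      (fun u : ℝ => (m + u ^ (1 / α) • v) i * (m + u ^ (1 / α) • v) k) (Set.Ioc 0 1) := by
  intro u hu
  have : u ^ (2 / α) = u ^ (1 / α) * u ^ (1 / α) := by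
    rw [← Real.rpow_add hu.1]; congr 1; ring
  simp only [this, Pi.add_apply, Pi.smul_apply, smul_eq_mul]
  ring

theorem integrableOn_ray (hα : 0 < α) (m v : Fin n → ℝ) (i : Fin n) :
    IntegrableOn (fun u : ℝ => (m + u ^ (1 / α) • v) i) (Set.Ioc 0 1) := by
  refine (integrableOn_affine_rpow hα (m i) (v i) 0).congr_fun (fun u _ => ?_) measurableSet_Ioc
  simp [mul_comm]

theorem integrableOn_ray_mul (hα : 0 < α) (m v : Fin n → ℝ) (i k : Fin n) :
    IntegrableOn (fun u : ℝ => (m + u ^ (1 / α) • v) i * (m + u ^ (1 / α) • v) k)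
      (Set.Ioc 0 1) :=
  (integrableOn_affine_rpow hα _ _ _).congr_fun (eqOn_ray_mul α m v i k) measurableSet_Ioc

theorem integrable_coord_rayMixture (hα : 0 < α) (i : Fin n) :
    Integrable (fun ξ => ξ i) (rayMixture α m w z) :=
  integrable_rayMixture (measurable_pi_apply i) fun j => integrableOn_ray hα m (z j) i

theorem integrable_coord_mul_rayMixture (hα : 0 < α) (i k : Fin n) :
    Integrable (fun ξ => ξ i * ξ k) (rayMixture α m w z) :=
  integrable_rayMixture ((measurable_pi_apply i).mul (measurable_pi_apply k))
    fun j => integrableOn_ray_mul hα m (z j) i k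

theorem integral_coord_rayMixture (hα : 0 < α) (hw : ∀ j, 0 ≤ w j) (hw1 : ∑ j, w j = 1)
    (i : Fin n) :
    ∫ ξ, ξ i ∂(rayMixture α m w z) = m i + α / (α + 1) * ∑ j, w j * z j i := by
  rw [integral_rayMixture hw (F := fun ξ => ξ i) (measurable_pi_apply i)
    fun j => integrableOn_ray hα m (z j) i]
  have : ∀ j, ∫ u in Set.Ioc (0 : ℝ) 1, (m + u ^ (1 / α) • z j) i =
      m i + z j i * (α / (α + 1)) := by
    intro j
    have h := integral_affine_rpow hα (m i) (z j i) 0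
    simp only [zero_mul, add_zero] at h
    rw [← h]
    simp [mul_comm]
  simp only [this]
  calc ∑ j, w j * (m i + z j i * (α / (α + 1)))
      = ∑ j, (m i * w j + α / (α + 1) * (w j * z j i)) :=
        Finset.sum_congr rfl fun j _ => by ring
    _ = _ := by rw [Finset.sum_add_distrib, ← Finset.mul_sum, ← Finset.mul_sum, hw1, mul_one]

theorem integral_coord_mul_rayMixture (hα : 0 < α) (hw : ∀ j, 0 ≤ w j) (hw1 : ∑ j, w j = 1)
    (i k : Fin n) :
    ∫ ξ, ξ i * ξ k ∂(rayMixture α m w z) = m i * m k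
      + α / (α + 1) * (m i * ∑ j, w j * z j k + m k * ∑ j, w j * z j i)
      + α / (α + 2) * ∑ j, w j * (z j i * z j k) := by
  rw [integral_rayMixture hw (F := fun ξ => ξ i * ξ k)
    ((measurable_pi_apply i).mul (measurable_pi_apply k))
    fun j => integrableOn_ray_mul hα m (z j) i k]
  simp only [← setIntegral_congr_fun measurableSet_Ioc (eqOn_ray_mul α m _ i k),
    integral_affine_rpow hα]
  calc ∑ j, w j * (m i * m k + (m i * z j k + m k * z j i) * (α / (α + 1))
        + z j i * z j k * (α / (α + 2)))
      = ∑ j, (m i * m k * w j + α / (α + 1) * m i * (w j * z j k)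
        + α / (α + 1) * m k * (w j * z j i) + α / (α + 2) * (w j * (z j i * z j k))) :=
        Finset.sum_congr rfl fun j _ => by ring
    _ = _ := by
      simp only [Finset.sum_add_distrib, ← Finset.mul_sum, hw1]
      ring

theorem rayMixture_halfspace_ge (hα : 0 < α) (hw : ∀ j, 0 ≤ w j) {a : Fin n → ℝ} {b h : ℝ}
    (hm : a ⬝ᵥ m ≤ b) (hh : b - a ⬝ᵥ m < h) (T : Finset J) (hT : ∀ j ∈ T, a ⬝ᵥ z j = h) :
    ENNReal.ofReal ((∑ j ∈ T, w j) * (1 - ((b - a ⬝ᵥ m) / h) ^ α)) ≤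
      rayMixture α m w z {ξ | b < a ⬝ᵥ ξ} := by
  have hdot : Measurable fun x : Fin n → ℝ => a ⬝ᵥ x := by
    simpa using measurable_dotProduct_sub a 0
  have hc : 0 ≤ b - a ⬝ᵥ m := sub_nonneg.2 hm
  have hh0 : 0 < h := hc.trans_lt hh
  rw [rayMixture_apply (measurableSet_lt measurable_const hdot),
    ENNReal.ofReal_mul (Finset.sum_nonneg fun j _ => hw j),
    ENNReal.ofReal_sum_of_nonneg fun j _ => hw j, Finset.sum_mul]
  refine le_trans (Finset.sum_le_sum fun j hj => ?_)
    (Finset.sum_le_sum_of_subset (Finset.subset_univ T))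
  gcongr
  rw [← Real.volume_Ioc]
  refine measure_mono fun u hu => ?_
  have hu0 : 0 < u := lt_of_le_of_lt (by positivity) hu.1
  refine ⟨?_, hu0, hu.2⟩
  have : (b - a ⬝ᵥ m) / h < u ^ (1 / α) := by
    calc (b - a ⬝ᵥ m) / h = (((b - a ⬝ᵥ m) / h) ^ α) ^ (1 / α) := by
          rw [one_div, Real.rpow_rpow_inv (by positivity) hα.ne']
      _ < u ^ (1 / α) := Real.rpow_lt_rpow (by positivity) hu.1 (by positivity)
  rw [div_lt_iff₀ hh0] at this
  simp only [Set.mem_ofPred_eq, dotProduct_add, dotProduct_smul, smul_eq_mul, hT j hj]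
  linarith

end rayMixture

section design

variable {n : ℕ}

theorem exists_residual_factor {L : Matrix (Fin n) (Fin n) ℝ} (hL : Lᵀ = L) {a : Fin n → ℝ}
    (hV : 0 < (L *ᵥ a) ⬝ᵥ (L *ᵥ a)) :
    ∃ (v : Fin n → ℝ) (M : Matrix (Fin n) (Fin n) ℝ),
      a ⬝ᵥ v = Real.sqrt ((L *ᵥ a) ⬝ᵥ (L *ᵥ a)) ∧ a ᵥ* M = 0 ∧
      M * Mᵀ + vecMulVec v v = L * L := by
  set σ := Real.sqrt ((L *ᵥ a) ⬝ᵥ (L *ᵥ a)) with hσ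
  have hσ0 : 0 < σ := Real.sqrt_pos.2 hV
  have hσσ : (L *ᵥ a) ⬝ᵥ (L *ᵥ a) = σ * σ := (Real.mul_self_sqrt hV.le).symm
  set u := σ⁻¹ • (L *ᵥ a) with hu
  have hLa : L *ᵥ a = σ • u := by rw [hu, smul_smul, mul_inv_cancel₀ hσ0.ne', one_smul]
  have haL : a ᵥ* L = σ • u := by rw [← hLa, ← mulVec_transpose, hL]
  have huu : u ⬝ᵥ u = 1 := by
    rw [hLa, smul_dotProduct, dotProduct_smul, smul_eq_mul, smul_eq_mul] at hσσ
    have : σ * σ * (u ⬝ᵥ u) = σ * σ * 1 := by linarith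
    exact mul_left_cancel₀ (by positivity) this
  have hav : a ⬝ᵥ (L *ᵥ u) = σ := by
    rw [dotProduct_mulVec, haL, smul_dotProduct, huu, smul_eq_mul, mul_one]
  have huL : u ᵥ* L = L *ᵥ u := by rw [← mulVec_transpose, hL]
  refine ⟨L *ᵥ u, L - vecMulVec (L *ᵥ u) u, hav, ?_, ?_⟩
  · rw [vecMul_sub, haL, vecMul_vecMulVec, hav, sub_self]
  · rw [transpose_sub, hL, transpose_vecMulVec, sub_mul, mul_sub, mul_sub, mul_vecMulVec,
      vecMulVec_mul, huL, vecMulVec_mul_vecMulVec, huu, one_smul]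
    abel

/-- A finitely supported law with mean `z₀`, covariance `L * L` and an atom of mass
`1 / (1 + s ^ 2)` for the projection along `a`, located `s` standard deviations above the mean. -/
theorem exists_finite_law (hn : 1 ≤ n) {L : Matrix (Fin n) (Fin n) ℝ} (hL : Lᵀ = L)
    {a : Fin n → ℝ} (hV : 0 < (L *ᵥ a) ⬝ᵥ (L *ᵥ a)) (z₀ : Fin n → ℝ) {s : ℝ} (hs : 0 < s) :
    ∃ (w : Bool × Fin n × Bool → ℝ) (z : Bool × Fin n × Bool → Fin n → ℝ)
      (T : Finset (Bool × Fin n × Bool)), (∀ j, 0 ≤ w j) ∧ ∑ j, w j = 1 ∧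
      (∀ i, ∑ j, w j * z j i = z₀ i) ∧
      (∀ i k, ∑ j, w j * (z j i * z j k) = (L * L) i k + z₀ i * z₀ k) ∧
      (∀ j ∈ T, a ⬝ᵥ z j = a ⬝ᵥ z₀ + s * Real.sqrt ((L *ᵥ a) ⬝ᵥ (L *ᵥ a))) ∧
      ∑ j ∈ T, w j = 1 / (1 + s ^ 2) := by
  obtain ⟨v, M, hav, haM, hM⟩ := exists_residual_factor hL hV
  have hn0 : (0 : ℝ) < n := by exact_mod_cast hn
  have hcol : ∀ l, a ⬝ᵥ (fun i => M i l) = 0 := fun l => congrFun haM l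
  have hs1 : 0 < 1 + s ^ 2 := by positivity
  have hr : Real.sqrt n * Real.sqrt n = n := Real.mul_self_sqrt hn0.le
  set r := Real.sqrt n with hr_def
  refine ⟨fun j => (if j.1 then 1 / (1 + s ^ 2) else s ^ 2 / (1 + s ^ 2)) / (2 * n),
    fun j => z₀ + (if j.1 then s else -1 / s) • v
      + (if j.2.2 then r else -r) • fun i => M i j.2.1,
    {true} ×ˢ Finset.univ, fun j => ?_, ?_, fun i => ?_, fun i k => ?_, fun j hj => ?_, ?_⟩
  · dsimp only
    split_ifs <;> positivity
  · simp only [Fintype.sum_prod_type, Fintype.sum_bool, Finset.sum_const, Finset.card_univ,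
      Fintype.card_fin, nsmul_eq_mul, if_true, Bool.false_eq_true, if_false]
    field_simp
    ring
  · simp only [Fintype.sum_prod_type, Fintype.sum_bool, if_true, Bool.false_eq_true, if_false,
      Pi.add_apply, Pi.smul_apply, smul_eq_mul]
    have e : ∀ (p y : ℝ) (l : Fin n), p / (2 * n) * (z₀ i + y * v i + r * M i l)
        + p / (2 * n) * (z₀ i + y * v i + -r * M i l) = p / n * (z₀ i + y * v i) := by
      intro p y l
      field_simp
      ring
    simp only [e, Finset.sum_const, Finset.card_univ, Fintype.card_fin, nsmul_eq_mul]
    field_simp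
    ring
  · simp only [Fintype.sum_prod_type, Fintype.sum_bool, if_true, Bool.false_eq_true, if_false,
      Pi.add_apply, Pi.smul_apply, smul_eq_mul]
    have e : ∀ (p y : ℝ) (l : Fin n), p / (2 * n) * ((z₀ i + y * v i + r * M i l)
          * (z₀ k + y * v k + r * M k l))
        + p / (2 * n) * ((z₀ i + y * v i + -r * M i l) * (z₀ k + y * v k + -r * M k l))
        = p / n * ((z₀ i + y * v i) * (z₀ k + y * v k)) + p * (M i l * M k l) := by
      intro p y l
      have : p / (2 * n) * ((z₀ i + y * v i + r * M i l)
          * (z₀ k + y * v k + r * M k l))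
        + p / (2 * n) * ((z₀ i + y * v i + -r * M i l) * (z₀ k + y * v k + -r * M k l))
        = p / n * ((z₀ i + y * v i) * (z₀ k + y * v k)) + p / n * (r * r) * (M i l * M k l) := by
        field_simp
        ring
      rw [this, hr, div_mul_cancel₀ _ hn0.ne']
    have hMM : ∑ l, M i l * M k l = (L * L) i k - v i * v k := by
      rw [← hM]
      simp [Matrix.mul_apply, vecMulVec_apply]
    simp only [e, Finset.sum_add_distrib, ← Finset.mul_sum, hMM, Finset.sum_const,
      Finset.card_univ, Fintype.card_fin, nsmul_eq_mul]
    field_simp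
    ring
  · have hj1 : j.1 = true := Finset.mem_singleton.1 (Finset.mem_product.1 hj).1
    simp only [hj1, if_true, dotProduct_add, dotProduct_smul, hcol, hav, smul_eq_mul, mul_zero,
      add_zero]
  · rw [Finset.sum_product]
    simp only [Finset.sum_singleton, if_true, Finset.sum_const, Finset.card_univ,
      Fintype.card_prod, Fintype.card_fin, Fintype.card_bool, nsmul_eq_mul]
    push_cast
    field_simp

end design

/-- A violated level `τ` yields a two-point law for which the tail function has mean above `ε`. -/
theorem exists_height_of_violation {α ε c σ w₀ τ : ℝ} (hα : 0 < α) (hε : 0 < ε) (hε1 : ε < 1)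
    (hc : 0 ≤ c) (hσ : 0 < σ) (hτ : (1 / (1 - ε)) ^ (1 / α) ≤ τ)
    (h : τ * c - w₀ < Real.sqrt ((1 - ε - τ ^ (-α)) / ε) * σ) :
    ∃ s : ℝ, 0 < s ∧ c < w₀ + s * σ ∧
      ε < 1 / (1 + s ^ 2) * (1 - (c / (w₀ + s * σ)) ^ α) := by
  have hbase : 1 < 1 / (1 - ε) := by rw [lt_div_iff₀ (by linarith)]; linarith
  have hτ₀ : 1 < (1 / (1 - ε)) ^ (1 / α) := Real.one_lt_rpow hbase (by positivity)
  obtain ⟨τ', hτ', h'⟩ : ∃ τ', τ < τ' ∧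
      τ' * c - w₀ < Real.sqrt ((1 - ε - τ' ^ (-α)) / ε) * σ := by
    have hcont : ContinuousAt
        (fun t : ℝ => Real.sqrt ((1 - ε - t ^ (-α)) / ε) * σ - (t * c - w₀)) τ := by
      have : ContinuousAt (fun t : ℝ => t ^ (-α)) τ :=
        Real.continuousAt_rpow_const _ _ (Or.inl (by linarith))
      fun_prop
    have hev := (hcont.eventually (lt_mem_nhds (sub_pos.2 h))).filter_mono
      (nhdsWithin_le_nhds (s := Set.Ioi τ))
    obtain ⟨t, ht, htτ⟩ := (hev.and self_mem_nhdsWithin).exists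
    exact ⟨t, htτ, sub_pos.1 ht⟩
  have hτ'1 : 1 < τ' := by linarith
  have hτ'0 : 0 < τ' := by linarith
  set g := 1 - τ' ^ (-α) with hg
  have hεg : ε < g := by
    have h1 : 1 / (1 - ε) < τ' ^ α := by
      calc 1 / (1 - ε) = ((1 / (1 - ε)) ^ (1 / α)) ^ α := by
            rw [one_div α, Real.rpow_inv_rpow (by positivity) hα.ne']
        _ < τ' ^ α := Real.rpow_lt_rpow (by positivity) (by linarith) hα
    have h2 : τ' ^ (-α) < 1 - ε := by
      rw [Real.rpow_neg hτ'0.le]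
      rw [one_div] at h1
      exact inv_lt_of_inv_lt₀ (by linarith) h1
    linarith
  set s₀ := Real.sqrt ((1 - ε - τ' ^ (-α)) / ε) with hs₀
  have hs₀pos : 0 < s₀ := Real.sqrt_pos.2 (div_pos (by linarith) hε)
  have hs₀sq : s₀ ^ 2 = (g - ε) / ε := by
    rw [hs₀, Real.sq_sqrt (div_nonneg (by linarith) hε.le), hg]
    ring
  obtain ⟨s, hs1, hs2⟩ := exists_between (show max 0 ((τ' * c - w₀) / σ) < s₀ from
    max_lt hs₀pos ((div_lt_iff₀ hσ).2 h'))
  have hs : 0 < s := (le_max_left _ _).trans_lt hs1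
  have hsσ : τ' * c < w₀ + s * σ := by
    have := (div_lt_iff₀ hσ).1 ((le_max_right _ _).trans_lt hs1)
    linarith
  have hx0 : 0 < w₀ + s * σ := lt_of_le_of_lt (by positivity) hsσ
  refine ⟨s, hs, lt_of_le_of_lt (by nlinarith) hsσ, ?_⟩
  have hf : g ≤ 1 - (c / (w₀ + s * σ)) ^ α := by
    have h1 : c / (w₀ + s * σ) ≤ τ'⁻¹ := by
      rw [div_le_iff₀ hx0, inv_mul_eq_div, le_div_iff₀ hτ'0]
      linarith
    have h2 := Real.rpow_le_rpow (div_nonneg hc hx0.le) h1 hα.le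
    rw [Real.inv_rpow hτ'0.le, ← Real.rpow_neg hτ'0.le] at h2
    linarith
  have hs1 : 0 < 1 + s ^ 2 := by positivity
  have hlt : s ^ 2 < (g - ε) / ε := by rw [← hs₀sq]; gcongr
  rw [lt_div_iff₀ hε] at hlt
  rw [one_div, inv_mul_eq_div, lt_div_iff₀ hs1]
  linarith

theorem exists_unimodal_violating {n : ℕ} (hn : 1 ≤ n) {α ε b τ : ℝ} {μ m a : Fin n → ℝ}
    {S L : Matrix (Fin n) (Fin n) ℝ} (hα : 0 < α) (hε : 0 < ε) (hε1 : ε < 1) (hm : a ⬝ᵥ m ≤ b)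
    (hL : L.PosSemidef)
    (hLsq : L * L = ((α + 2) / α) • (S - vecMulVec μ μ)
        - (1 / α ^ 2) • vecMulVec (μ - m) (μ - m))
    (hpos : 0 < (L *ᵥ a) ⬝ᵥ (L *ᵥ a)) (hτ : (1 / (1 - ε)) ^ (1 / α) ≤ τ)
    (h : τ * (b - μ ⬝ᵥ a) + (τ - (α + 1) / α) * ((μ - m) ⬝ᵥ a) <
      Real.sqrt ((1 - ε - τ ^ (-α)) / ε) * Real.sqrt ((L *ᵥ a) ⬝ᵥ (L *ᵥ a))) :
    ∃ P : Measure (Fin n → ℝ), IsProbabilityMeasure P ∧ AlphaUnimodal α m P ∧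
      (∀ i, Integrable (fun ξ => ξ i) P) ∧ (∀ i j, Integrable (fun ξ => ξ i * ξ j) P) ∧
      (∀ i, (∫ ξ, ξ i ∂P) = μ i) ∧ (∀ i j, (∫ ξ, ξ i * ξ j ∂P) = S i j) ∧
      P {ξ | a ⬝ᵥ ξ ≤ b} < ENNReal.ofReal (1 - ε) := by
  set z₀ : Fin n → ℝ := ((α + 1) / α) • (μ - m) with hz₀
  have hc : 0 ≤ b - a ⬝ᵥ m := sub_nonneg.2 hm
  obtain ⟨s, hs, hcs, hεs⟩ := exists_height_of_violation (w₀ := a ⬝ᵥ z₀) hα hε hε1 hc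
    (Real.sqrt_pos.2 hpos) hτ (by
      refine lt_of_eq_of_lt ?_ h
      rw [hz₀, dotProduct_smul, dotProduct_sub, sub_dotProduct, dotProduct_comm μ,
        dotProduct_comm m, smul_eq_mul]
      ring)
  obtain ⟨w, z, T, hw, hw1, hz, hzz, hT, hTw⟩ :=
    exists_finite_law hn (by simpa using hL.isHermitian.eq) hpos z₀ hs
  have hprob := isProbabilityMeasure_rayMixture (α := α) (m := m) (z := z) hw hw1
  refine ⟨rayMixture α m w z, hprob, alphaUnimodal_rayMixture hα hw hw1,
    integrable_coord_rayMixture hα, integrable_coord_mul_rayMixture hα, fun i => ?_,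
    fun i k => ?_, ?_⟩
  · rw [integral_coord_rayMixture hα hw hw1, hz, hz₀]
    simp only [Pi.smul_apply, Pi.sub_apply, smul_eq_mul]
    field_simp
    ring
  · rw [integral_coord_mul_rayMixture hα hw hw1, hz, hz, hzz, hLsq, hz₀]
    simp only [Pi.smul_apply, Pi.sub_apply, smul_eq_mul, Matrix.sub_apply, Matrix.smul_apply,
      vecMulVec_apply]
    field_simp
    ring
  · have hge := rayMixture_halfspace_ge hα hw hm hcs T hT
    rw [hTw] at hge
    have hdot : Measurable fun x : Fin n → ℝ => a ⬝ᵥ x := by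
      simpa using measurable_dotProduct_sub a 0
    have hcompl : {ξ : Fin n → ℝ | a ⬝ᵥ ξ ≤ b} = {ξ | b < a ⬝ᵥ ξ}ᶜ := by
      ext ξ; simp
    rw [hcompl, prob_compl_eq_one_sub (measurableSet_lt measurable_const hdot)]
    have hlt : ENNReal.ofReal ε < rayMixture α m w z {ξ | b < a ⬝ᵥ ξ} :=
      ((ENNReal.ofReal_lt_ofReal_iff (hε.trans hεs)).2 hεs).trans_le hge
    rw [ENNReal.ofReal_sub _ hε.le, ENNReal.ofReal_one]
    exact (ENNReal.cancel_of_ne (ENNReal.sub_ne_top ENNReal.one_ne_top)).tsub_lt_tsub_left_of_le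
      prob_le_one hlt

theorem stmt2 (n : ℕ) (hn : 1 ≤ n) (α : ℝ) (hα : 1 ≤ α) (ε : ℝ)
    (hε : ε ∈ Set.Ioo (0 : ℝ) (1 / 2)) (μ : Fin n → ℝ) (S : Matrix (Fin n) (Fin n) ℝ)
    (hS : S.IsSymm) (a : Fin n → ℝ) (b : ℝ)
    (Ξ : Set (Fin n → ℝ)) (hΞne : Ξ.Nonempty) (hΞcp : IsCompact Ξ)
    (hpd : ∀ m ∈ Ξ, (((α + 2) / α) • (S - vecMulVec μ μ)
        - (1 / α ^ 2) • vecMulVec (μ - m) (μ - m)).PosDef)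
    (hmode : ∀ m ∈ Ξ, a ⬝ᵥ m ≤ b)
    (Λ : (Fin n → ℝ) → Matrix (Fin n) (Fin n) ℝ)
    (hΛ : ∀ m ∈ Ξ, (Λ m).PosSemidef)
    (hΛsq : ∀ m ∈ Ξ, Λ m * Λ m = ((α + 2) / α) • (S - vecMulVec μ μ)
        - (1 / α ^ 2) • vecMulVec (μ - m) (μ - m)) :
    (∀ P : Measure (Fin n → ℝ), IsProbabilityMeasure P →
      (∃ m ∈ Ξ, AlphaUnimodal α m P) →
      (∀ i, Integrable (fun ξ => ξ i) P) →
      (∀ i j, Integrable (fun ξ => ξ i * ξ j) P) →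
      (∀ i, (∫ ξ, ξ i ∂P) = μ i) →
      (∀ i j, (∫ ξ, ξ i * ξ j ∂P) = S i j) →
      ENNReal.ofReal (1 - ε) ≤ P {ξ | a ⬝ᵥ ξ ≤ b}) ↔
    (∀ m ∈ Ξ, ∀ τ : ℝ, (1 / (1 - ε)) ^ (1 / α) ≤ τ →
      Real.sqrt ((1 - ε - τ ^ (-α)) / ε) * Real.sqrt ((Λ m *ᵥ a) ⬝ᵥ (Λ m *ᵥ a)) ≤
        τ * (b - μ ⬝ᵥ a) + (τ - (α + 1) / α) * ((μ - m) ⬝ᵥ a)) := by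
  have hε1 : ε < 1 := by linarith [hε.2]
  have hα0 : 0 < α := by linarith
  have hpos : a ≠ 0 → ∀ m ∈ Ξ, 0 < (Λ m *ᵥ a) ⬝ᵥ (Λ m *ᵥ a) := by
    intro ha m hm
    have hT : (Λ m)ᵀ = Λ m := by simpa using (hΛ m hm).isHermitian.eq
    have h := (hpd m hm).dotProduct_mulVec_pos ha
    rw [← hΛsq m hm, star_trivial, ← mulVec_mulVec, dotProduct_mulVec, ← mulVec_transpose, hT] at h
    exact h
  rcases eq_or_ne a 0 with rfl | ha
  · obtain ⟨m₀, hm₀⟩ := hΞne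
    have hb : 0 ≤ b := by simpa using hmode m₀ hm₀
    refine iff_of_true (fun P hP _ _ _ _ _ => ?_) fun m _ τ hτ => ?_
    · simp only [zero_dotProduct, hb, Set.ofPred_true, measure_univ]
      exact ENNReal.ofReal_le_one.2 (by linarith [hε.1])
    · have hτ0 : 0 ≤ τ := le_trans
        (Real.rpow_nonneg (one_div_nonneg.2 (by linarith)) _) hτ
      simpa using mul_nonneg hτ0 hb
  constructor
  · intro H m hm τ hτ
    by_contra! hlt
    obtain ⟨P, hP, hU, h₁, h₂, hμ, hS', hPlt⟩ := exists_unimodal_violating hn hα0 hε.1 hε1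
      (hmode m hm) (hΛ m hm) (hΛsq m hm) (hpos ha m hm) hτ hlt
    exact (H P hP ⟨m, hm, hU⟩ h₁ h₂ hμ hS').not_gt hPlt
  · rintro H P hP ⟨m, hm, hU⟩ h₁ h₂ hμ hS'
    exact hU.prob_halfspace_ge hα hε.1 hε1 h₁ h₂ hμ hS' (hmode m hm) (hΛ m hm) (hΛsq m hm)
      (hpos ha m hm) (H m hm)
end

section
/- Let α ≥ 1 and ε ∈ (0, 1/2) be reals, and let R̃ > 0. Then ĥ(τ) → −R̃ as τ → ∞, and for every h ∈ (−R̃, R̃) there exists a unique τ > τ₀ with ĥ(τ) = h. -/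
/-- `τ₀ = (1/(1-ε))^(1/α)`. -/
noncomputable def tau0 (α ε : ℝ) : ℝ := (1 / (1 - ε)) ^ (1 / α)

/-- `g(τ) = √((1-ε-τ^(-α))/ε)`. -/
noncomputable def gfun (α ε τ : ℝ) : ℝ := Real.sqrt ((1 - ε - τ ^ (-α)) / ε)

/-- `f(τ) = -(ατ - α - 1)`. -/
noncomputable def ffun (α τ : ℝ) : ℝ := -(α * τ - α - 1)

/-- `ĥ(τ) = f(τ)·R̃/√(g(τ)² + f(τ)²)`. -/
noncomputable def hhat (α ε R τ : ℝ) : ℝ :=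
  ffun α τ * R / Real.sqrt ((gfun α ε τ) ^ 2 + (ffun α τ) ^ 2)

/-- The smooth expression under the square root of `gfun`. -/
noncomputable def gsq (α ε τ : ℝ) : ℝ := (1 - ε - τ ^ (-α)) / ε

lemma tau0_pos {α ε : ℝ} (hε : ε < 1) : 0 < tau0 α ε := by
  have : 0 < 1 - ε := by linarith
  unfold tau0
  positivity

lemma tau0_rpow_neg {α ε : ℝ} (hα : 0 < α) (hε : ε < 1) : tau0 α ε ^ (-α) = 1 - ε := by
  have h : 0 < 1 - ε := by linarith
  unfold tau0
  rw [← Real.rpow_mul (by positivity), show 1 / α * -α = -1 by field_simp, Real.rpow_neg_one]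
  simp

lemma gsq_tau0 {α ε : ℝ} (hα : 0 < α) (hε : ε < 1) : gsq α ε (tau0 α ε) = 0 := by
  simp [gsq, tau0_rpow_neg hα hε]

lemma gsq_pos {α ε τ : ℝ} (hα : 0 < α) (hε₀ : 0 < ε) (hε : ε < 1) (hτ : tau0 α ε < τ) :
    0 < gsq α ε τ := by
  have h := Real.rpow_lt_rpow_of_neg (tau0_pos hε) hτ (neg_lt_zero.mpr hα)
  rw [tau0_rpow_neg hα hε] at h
  exact div_pos (by linarith) hε₀

lemma gsq_nonneg {α ε τ : ℝ} (hα : 0 < α) (hε₀ : 0 < ε) (hε : ε < 1) (hτ : tau0 α ε ≤ τ) :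
    0 ≤ gsq α ε τ := by
  rcases hτ.eq_or_lt with rfl | h
  · rw [gsq_tau0 hα hε]
  · exact (gsq_pos hα hε₀ hε h).le

lemma hhat_eq {α ε R τ : ℝ} (hα : 0 < α) (hε₀ : 0 < ε) (hε : ε < 1) (hτ : tau0 α ε ≤ τ) :
    hhat α ε R τ = ffun α τ * R / Real.sqrt (gsq α ε τ + ffun α τ ^ 2) := by
  have h : gfun α ε τ ^ 2 = gsq α ε τ := Real.sq_sqrt (gsq_nonneg hα hε₀ hε hτ)
  rw [hhat, h]

lemma two_le_one_add_inv_rpow {α : ℝ} (hα : 1 ≤ α) : 2 ≤ (1 + 1 / α) ^ α := by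
  have h₀ : 0 < 1 / α := by positivity
  have h := one_add_mul_self_le_rpow_one_add (show -1 ≤ 1 / α by linarith) hα
  rw [mul_one_div_cancel (by positivity)] at h
  linarith

/-- The tangent-line bound giving monotonicity of `hhat` where `ffun` is nonpositive. -/
lemma affine_le_mul_rpow {α τ : ℝ} (hα : 1 ≤ α) (hτ : α + 1 ≤ α * τ) :
    (α + 2) * τ - (α + 1) ≤ τ * τ ^ α := by
  have hα₀ : 0 < α := by linarith
  have hc : 0 < 1 + 1 / α := by positivity
  have hcα : α * (1 + 1 / α) = α + 1 := by field_simp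
  have hcτ : 1 + 1 / α ≤ τ := by
    rw [← hcα] at hτ
    exact le_of_mul_le_mul_left hτ hα₀
  have hτ₀ : 0 < τ := hc.trans_le hcτ
  generalize hcdef : 1 + 1 / α = c at hc hcα hcτ
  have hc2 : 2 ≤ c ^ α := hcdef ▸ two_le_one_add_inv_rpow hα
  have hq : 0 ≤ τ / c - 1 := by
    rw [sub_nonneg, le_div_iff₀ hc]
    linarith
  have hb := one_add_mul_self_le_rpow_one_add (show -1 ≤ τ / c - 1 by linarith) hα
  rw [add_sub_cancel] at hb
  have hsplit : τ ^ α = c ^ α * (τ / c) ^ α := by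
    rw [← Real.mul_rpow hc.le (by positivity), mul_div_cancel₀ _ hc.ne']
  have h₁ : 2 * (1 + α * (τ / c - 1)) ≤ τ ^ α := by
    rw [hsplit]
    exact mul_le_mul hc2 hb (by positivity) (by positivity)
  have h₂ : τ - c ≤ τ * (τ / c - 1) := by
    have : τ - c = c * (τ / c - 1) := by field_simp
    rw [this]
    exact mul_le_mul_of_nonneg_right hcτ hq
  have h₃ := mul_le_mul_of_nonneg_left h₁ hτ₀.le
  have h₄ := mul_le_mul_of_nonneg_left h₂ hα₀.le
  nlinarith

lemma ffun_tau0_pos {α ε : ℝ} (hα : 1 ≤ α) (hε : ε < 1 / 2) : 0 < ffun α (tau0 α ε) := by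
  have hα₀ : 0 < α := by linarith
  have h₁ : 0 < 1 - ε := by linarith
  have h₂ : 1 / (1 - ε) < (1 + 1 / α) ^ α :=
    lt_of_lt_of_le (by rw [div_lt_iff₀ h₁]; linarith) (two_le_one_add_inv_rpow hα)
  have h₃ : tau0 α ε < 1 + 1 / α := by
    have h := Real.rpow_lt_rpow (by positivity) h₂ (show 0 < 1 / α by positivity)
    rwa [← Real.rpow_mul (by positivity), mul_one_div_cancel hα₀.ne', Real.rpow_one] at h
  have h₄ := mul_lt_mul_of_pos_left h₃ hα₀
  have h₅ : α * (1 + 1 / α) = α + 1 := by field_simp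
  unfold ffun
  linarith

lemma gsq_add_ffun_sq_pos {α ε τ : ℝ} (hα : 1 ≤ α) (hε₀ : 0 < ε) (hε : ε < 1 / 2)
    (hτ : tau0 α ε ≤ τ) : 0 < gsq α ε τ + ffun α τ ^ 2 := by
  have hα₀ : 0 < α := by linarith
  rcases hτ.eq_or_lt with rfl | h
  · have := ffun_tau0_pos hα hε
    rw [gsq_tau0 hα₀ (by linarith)]
    positivity
  · have := gsq_pos hα₀ hε₀ (by linarith) h
    positivity

lemma hasDerivAt_gsq {α ε τ : ℝ} (hτ : 0 < τ) :
    HasDerivAt (gsq α ε) (α * (τ ^ (-α) / τ) / ε) τ := by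
  have h := ((Real.hasDerivAt_rpow_const (p := -α) (Or.inl hτ.ne')).const_sub (1 - ε)).div_const ε
  refine h.congr_deriv ?_
  rw [Real.rpow_sub_one hτ.ne']
  ring

lemma hasDerivAt_ffun (α τ : ℝ) : HasDerivAt (ffun α) (-α) τ := by
  have h := ((((hasDerivAt_id τ).const_mul α).sub_const α).sub_const 1).neg
  exact h.congr_deriv (by simp)

/-- Positivity of the numerator of `-ĥ'`. -/
lemma two_mul_gsq_add_pos {α ε τ : ℝ} (hα : 1 ≤ α) (hε₀ : 0 < ε) (hε : ε < 1 / 2)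
    (hτ : tau0 α ε < τ) :
    0 < 2 * α * gsq α ε τ + ffun α τ * (α * (τ ^ (-α) / τ) / ε) := by
  have hα₀ : 0 < α := by linarith
  have hτ₀ : 0 < τ := (tau0_pos (by linarith)).trans hτ
  have hg := gsq_pos hα₀ hε₀ (by linarith) hτ
  have hu : 0 < τ ^ (-α) := by positivity
  rcases le_total 0 (ffun α τ) with hf | hf
  · positivity
  · have hb := affine_le_mul_rpow hα (show α + 1 ≤ α * τ by unfold ffun at hf; linarith)
    have hmul : τ ^ (-α) * τ ^ α = 1 := by
      rw [← Real.rpow_add hτ₀]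
      simp
    have hle : τ ^ (-α) * ((α + 2) * τ - (α + 1)) / τ ≤ 1 := by
      rw [div_le_one hτ₀]
      calc τ ^ (-α) * ((α + 2) * τ - (α + 1)) ≤ τ ^ (-α) * (τ * τ ^ α) := by gcongr
        _ = τ := by linear_combination τ * hmul
    have heq : 2 * α * gsq α ε τ + ffun α τ * (α * (τ ^ (-α) / τ) / ε) =
        α / ε * (2 * (1 - ε) - τ ^ (-α) * ((α + 2) * τ - (α + 1)) / τ) := by
      unfold gsq ffun
      field_simp
      ring
    rw [heq]
    exact mul_pos (by positivity) (by linarith)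

lemma continuousOn_hhat {α ε R : ℝ} (hα : 1 ≤ α) (hε₀ : 0 < ε) (hε : ε < 1 / 2) :
    ContinuousOn (hhat α ε R) (Set.Ici (tau0 α ε)) := by
  have hk : ContinuousOn (fun τ ↦ ffun α τ * R / Real.sqrt (gsq α ε τ + ffun α τ ^ 2))
      (Set.Ici (tau0 α ε)) := by
    intro τ hτ
    have hg := (hasDerivAt_gsq (α := α) (ε := ε)
      ((tau0_pos (by linarith)).trans_le hτ)).continuousAt
    have hf := (hasDerivAt_ffun α τ).continuousAt
    exact ((hf.mul_const R).div (hg.add (hf.pow 2)).sqrt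
      (Real.sqrt_pos.mpr (gsq_add_ffun_sq_pos hα hε₀ hε hτ)).ne').continuousWithinAt
  exact hk.congr fun τ hτ ↦ hhat_eq (by linarith) hε₀ (by linarith) hτ

lemma strictAntiOn_hhat {α ε R : ℝ} (hα : 1 ≤ α) (hε₀ : 0 < ε) (hε : ε < 1 / 2) (hR : 0 < R) :
    StrictAntiOn (hhat α ε R) (Set.Ici (tau0 α ε)) := by
  refine strictAntiOn_of_deriv_neg (convex_Ici _) (continuousOn_hhat hα hε₀ hε) fun τ hτ ↦ ?_
  rw [interior_Ici] at hτ
  have hτ' : tau0 α ε < τ := hτ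
  have hD := gsq_add_ffun_sq_pos hα hε₀ hε hτ'.le
  have hs := Real.sqrt_pos.mpr hD
  have hsq := Real.sq_sqrt hD.le
  have hN := two_mul_gsq_add_pos hα hε₀ hε hτ'
  have hf := hasDerivAt_ffun α τ
  have hg := hasDerivAt_gsq (α := α) (ε := ε) ((tau0_pos (by linarith)).trans hτ')
  have hk := (hf.mul_const R).fun_div ((hg.fun_add (hf.fun_pow 2)).sqrt hD.ne') hs.ne'
  have heq : hhat α ε R =ᶠ[nhds τ]
      fun τ ↦ ffun α τ * R / Real.sqrt (gsq α ε τ + ffun α τ ^ 2) := by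
    filter_upwards [Ioi_mem_nhds hτ'] with t ht
    exact hhat_eq (by linarith) hε₀ (by linarith) (le_of_lt ht)
  rw [(hk.congr_of_eventuallyEq heq).deriv]
  refine div_neg_of_neg_of_pos ?_ (by positivity)
  generalize α * (τ ^ (-α) / τ) / ε = g' at hN
  generalize Real.sqrt (gsq α ε τ + ffun α τ ^ 2) = s at hs hsq
  have hnum : -α * R * s - ffun α τ * R * ((g' + 2 * ffun α τ * -α) / (2 * s)) =
      -(R * (2 * α * gsq α ε τ + ffun α τ * g') / (2 * s)) := by
    field_simp
    linear_combination (-2 * α) * hsq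
  simp only [Nat.cast_ofNat, Nat.add_one_sub_one, pow_one]
  rw [hnum]
  exact neg_lt_zero.mpr (by positivity)

lemma tendsto_hhat_atTop {α ε R : ℝ} (hα : 0 < α) (hε₀ : 0 < ε) (hε : ε < 1) :
    Filter.Tendsto (hhat α ε R) Filter.atTop (nhds (-R)) := by
  have hg : Filter.Tendsto (gsq α ε) Filter.atTop (nhds ((1 - ε - 0) / ε)) :=
    ((tendsto_rpow_neg_atTop hα).const_sub (1 - ε)).div_const ε
  have hF : Filter.Tendsto (ffun α) Filter.atTop Filter.atBot := by
    have h : Filter.Tendsto (fun τ : ℝ ↦ α * τ + (-α - 1)) Filter.atTop Filter.atTop :=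
      Filter.tendsto_atTop_add_const_right _ _ (Filter.tendsto_id.const_mul_atTop hα)
    refine (Filter.tendsto_neg_atTop_atBot.comp h).congr fun τ ↦ ?_
    simp only [Function.comp, ffun]
    ring
  have hF2 : Filter.Tendsto (fun τ ↦ ffun α τ ^ 2) Filter.atTop Filter.atTop := by
    simpa only [sq] using hF.atBot_mul_atBot₀ hF
  have hlim : Filter.Tendsto (fun τ ↦ -R / Real.sqrt (gsq α ε τ / ffun α τ ^ 2 + 1))
      Filter.atTop (nhds (-R)) := by
    have h := ((hg.div_atTop hF2).add_const 1).sqrt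
    have h' := (tendsto_const_nhds (x := -R)).div h (by simp)
    simpa [Pi.div_def] using h'
  refine hlim.congr' ?_
  filter_upwards [hF.eventually_lt_atBot 0, Filter.eventually_ge_atTop (tau0 α ε)] with τ hf hτ
  rw [hhat_eq hα hε₀ hε hτ]
  have hg₀ := gsq_nonneg hα hε₀ hε hτ
  have hsplit : gsq α ε τ + ffun α τ ^ 2 =
      (-ffun α τ) ^ 2 * (gsq α ε τ / ffun α τ ^ 2 + 1) := by
    field_simp [hf.ne]
  rw [hsplit, Real.sqrt_mul (sq_nonneg _), Real.sqrt_sq (by linarith)]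
  have hs : 0 < Real.sqrt (gsq α ε τ / ffun α τ ^ 2 + 1) := Real.sqrt_pos.mpr (by positivity)
  have := hf.ne
  field_simp

lemma hhat_tau0 {α ε R : ℝ} (hα : 1 ≤ α) (hε₀ : 0 < ε) (hε : ε < 1 / 2) :
    hhat α ε R (tau0 α ε) = R := by
  have hf := ffun_tau0_pos hα hε
  rw [hhat_eq (by linarith) hε₀ (by linarith) le_rfl, gsq_tau0 (by linarith) (by linarith),
    zero_add, Real.sqrt_sq hf.le, mul_div_cancel_left₀ _ hf.ne']

theorem stmt5 (α ε R : ℝ) (hα : 1 ≤ α) (hε : ε ∈ Set.Ioo (0 : ℝ) (1 / 2)) (hR : 0 < R) :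
    Filter.Tendsto (hhat α ε R) Filter.atTop (nhds (-R)) ∧
    ∀ h ∈ Set.Ioo (-R) R, ∃! τ : ℝ, tau0 α ε < τ ∧ hhat α ε R τ = h := by
  obtain ⟨hε₀, hε₁⟩ := hε
  have hlim := tendsto_hhat_atTop (R := R) (show 0 < α by linarith) hε₀ (show ε < 1 by linarith)
  refine ⟨hlim, fun h hh ↦ ?_⟩
  obtain ⟨T, hT, hTτ⟩ :=
    ((hlim.eventually_lt_const hh.1).and (Filter.eventually_ge_atTop (tau0 α ε))).exists
  have hcont := (continuousOn_hhat (R := R) hα hε₀ hε₁).mono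
    (show Set.Icc (tau0 α ε) T ⊆ Set.Ici (tau0 α ε) from Set.Icc_subset_Ici_self)
  obtain ⟨τ, hτ, rfl⟩ := intermediate_value_Ioo' hTτ hcont
    ⟨hT, (hhat_tau0 (R := R) hα hε₀ hε₁).symm ▸ hh.2⟩
  exact ⟨τ, ⟨hτ.1, rfl⟩, fun σ hσ ↦
    (strictAntiOn_hhat hα hε₀ hε₁ hR).injOn hσ.1.le hτ.1.le hσ.2⟩
end
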